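/- Let k be an algebraically closed field, A a finite-dimensional k-algebra, and T = U ⊕ X a basic semi-tilting left A-module with X indecomposable, X not in add U, and X ∈ gen U. Let 0 → Y →μ→ E →ε→ X → 0 be a short exact sequence with ε : E → X a minimal right add U-approximation, assume dim_k Ext^1_A(X,Y) = 1, and set B = End_A(T). Then the cokernel of the induced map ε_* = Hom_A(T,ε) : Hom_A(T,E) → Hom_A(T,X) is a simple right B-module. -/

import Mathlib

open CategoryTheory

noncomputable section

/-- `M` belongs to `add U`: `M` is (isomorphic to) a direct summand of a finite
direct sum of copies of `U`, i.e. `M` is a split submodule of some `U ^ n`. -/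
def InAdd (A : Type) [Ring A] (U : Type) [AddCommGroup U] [Module A U]
    (M : Type) [AddCommGroup M] [Module A M] : Prop :=
  ∃ (n : ℕ) (i : M →ₗ[A] (Fin n → U)) (p : (Fin n → U) →ₗ[A] M), p ∘ₗ i = LinearMap.id

/-- `M` belongs to `gen U`: there is a surjection `U ^ n → M` for some `n ≥ 1`. -/
def InGen (A : Type) [Ring A] (U : Type) [AddCommGroup U] [Module A U]
    (M : Type) [AddCommGroup M] [Module A M] : Prop :=
  ∃ n : ℕ, 1 ≤ n ∧ ∃ p : (Fin n → U) →ₗ[A] M, Function.Surjective p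

/-- `M` belongs to `cogen U`: there is an injection `M → U ^ n` for some `n ≥ 1`. -/
def InCogen (A : Type) [Ring A] (U : Type) [AddCommGroup U] [Module A U]
    (M : Type) [AddCommGroup M] [Module A M] : Prop :=
  ∃ n : ℕ, 1 ≤ n ∧ ∃ i : M →ₗ[A] (Fin n → U), Function.Injective i

/-- `ε : E → X` is a right `add U`-approximation of `X`. -/
def IsRightAddApprox (A : Type) [Ring A] (U : Type) [AddCommGroup U] [Module A U]
    {E X : Type} [AddCommGroup E] [Module A E] [AddCommGroup X] [Module A X]
    (ε : E →ₗ[A] X) : Prop :=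
  InAdd A U E ∧ ∀ (C : Type) [AddCommGroup C] [Module A C], InAdd A U C →
    ∀ f : C →ₗ[A] X, ∃ g : C →ₗ[A] E, ε ∘ₗ g = f

/-- `ε : E → X` is a minimal right `add U`-approximation of `X`. -/
def IsMinimalRightAddApprox (A : Type) [Ring A] (U : Type) [AddCommGroup U] [Module A U]
    {E X : Type} [AddCommGroup E] [Module A E] [AddCommGroup X] [Module A X]
    (ε : E →ₗ[A] X) : Prop :=
  IsRightAddApprox A U ε ∧ ∀ g : E →ₗ[A] E, ε ∘ₗ g = ε → Function.Bijective g

/-- `μ : Y → E` is a left `add U`-approximation of `Y`. -/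
def IsLeftAddApprox (A : Type) [Ring A] (U : Type) [AddCommGroup U] [Module A U]
    {Y E : Type} [AddCommGroup Y] [Module A Y] [AddCommGroup E] [Module A E]
    (μ : Y →ₗ[A] E) : Prop :=
  InAdd A U E ∧ ∀ (C : Type) [AddCommGroup C] [Module A C], InAdd A U C →
    ∀ f : Y →ₗ[A] C, ∃ g : E →ₗ[A] C, g ∘ₗ μ = f

/-- `μ : Y → E` is a minimal left `add U`-approximation of `Y`. -/
def IsMinimalLeftAddApprox (A : Type) [Ring A] (U : Type) [AddCommGroup U] [Module A U]
    {Y E : Type} [AddCommGroup Y] [Module A Y] [AddCommGroup E] [Module A E]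
    (μ : Y →ₗ[A] E) : Prop :=
  IsLeftAddApprox A U μ ∧ ∀ g : E →ₗ[A] E, g ∘ₗ μ = μ → Function.Bijective g

/-- A module is indecomposable: it is nonzero and is not the internal direct sum of two
nonzero submodules. -/
def IsIndecomposableModule (A : Type) [Ring A] (M : Type) [AddCommGroup M] [Module A M] :
    Prop :=
  Nontrivial M ∧ ∀ N₁ N₂ : Submodule A M, IsCompl N₁ N₂ → N₁ = ⊥ ∨ N₂ = ⊥

/-- A module is basic: it is an internal direct sum of finitely many indecomposable
submodules that are pairwise non-isomorphic. -/
def IsBasicModule (A : Type) [Ring A] (M : Type) [AddCommGroup M] [Module A M] : Prop :=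
  ∃ (n : ℕ) (N : Fin n → Submodule A M),
    DirectSum.IsInternal N ∧ (∀ i, IsIndecomposableModule A (N i)) ∧
      ∀ i j : Fin n, i ≠ j → IsEmpty ((N i) ≃ₗ[A] (N j))

/-- `AddCoresChain A T n M` expresses that there is an exact sequence
`0 → M → T₀ → T₁ → ⋯ → Tₙ → 0` with all `Tᵢ ∈ add T`
(encoded recursively via cokernels). -/
def AddCoresChain (A : Type) [Ring A] (T : Type) [AddCommGroup T] [Module A T] :
    (n : ℕ) → (M : Type) → [AddCommGroup M] → [Module A M] → Prop
  | 0, M, _, _ => InAdd A T M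
  | n + 1, M, _, _ => ∃ (T₀ : Type) (_ : AddCommGroup T₀) (_ : Module A T₀)
      (f : M →ₗ[A] T₀), Function.Injective f ∧ InAdd A T T₀ ∧
        AddCoresChain A T n (T₀ ⧸ LinearMap.range f)

/-- The self-extension groups `Ext^i_A(T, T)` vanish for all `i ≥ 1`. -/
def ExtSelfVanish (k : Type) [Field k] (A : Type) [Ring A] [Algebra k A]
    (T : Type) [AddCommGroup T] [Module A T] : Prop :=
  ∀ i : ℕ, 1 ≤ i → Subsingleton
    (((Ext k (ModuleCat.{0} A) i).obj (Opposite.op (ModuleCat.of A T))).obj (ModuleCat.of A T))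

/-- `T` is a semi-tilting `A`-module: `Ext^i_A(T,T) = 0` for all `i ≥ 1` and there is an
exact sequence `0 → A → T₀ → ⋯ → Tₙ → 0` with all `Tᵢ ∈ add T`. -/
def IsSemiTilting (k : Type) [Field k] (A : Type) [Ring A] [Algebra k A]
    (T : Type) [AddCommGroup T] [Module A T] : Prop :=
  ExtSelfVanish k A T ∧ ∃ n : ℕ, AddCoresChain A T n A

/-- `M` has projective dimension at most `1` over `B`: it admits a projective
resolution `0 → P₁ → P₀ → M → 0`. -/
def HasProjDimLE1 (B : Type) [Ring B] (M : Type) [AddCommGroup M] [Module B M] : Prop :=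
  ∃ (P₀ P₁ : Type) (_ : AddCommGroup P₀) (_ : Module B P₀)
    (_ : AddCommGroup P₁) (_ : Module B P₁),
    Module.Projective B P₀ ∧ Module.Projective B P₁ ∧
      ∃ (ι : P₁ →ₗ[B] P₀) (π : P₀ →ₗ[B] M),
        Function.Injective ι ∧ Function.Surjective π ∧ LinearMap.range ι = LinearMap.ker π

/-- `M` has projective dimension exactly `1` over `B`. -/
def HasProjDimEq1 (B : Type) [Ring B] (M : Type) [AddCommGroup M] [Module B M] : Prop :=
  HasProjDimLE1 B M ∧ ¬ Module.Projective B M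

/-- `Ext^1_B(M, M) = 0`. -/
def ExtOneSelfVanish (B : Type) [Ring B] (M : Type) [AddCommGroup M] [Module B M] : Prop :=
  Subsingleton
    (((Ext ℤ (ModuleCat.{0} B) 1).obj (Opposite.op (ModuleCat.of B M))).obj (ModuleCat.of B M))

/-- `M` is a tilting `B`-module of projective dimension exactly one. -/
def IsTiltingOfProjDimOne (B : Type) [Ring B] (M : Type) [AddCommGroup M] [Module B M] :
    Prop :=
  HasProjDimEq1 B M ∧ ExtOneSelfVanish B M ∧
    ∃ (M₀ M₁ : Type) (_ : AddCommGroup M₀) (_ : Module B M₀)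
      (_ : AddCommGroup M₁) (_ : Module B M₁),
      InAdd B M M₀ ∧ InAdd B M M₁ ∧
        ∃ (f : B →ₗ[B] M₀) (g : M₀ →ₗ[B] M₁),
          Function.Injective f ∧ Function.Surjective g ∧ LinearMap.range f = LinearMap.ker g

/-- The right action (by precomposition) of `(End_A T)ᵐᵒᵖ` on `Hom_A(T, N)`,
making `Hom_A(T, N)` a right `End_A T`-module. -/
instance endOpModule (A : Type) [Ring A] (T : Type) [AddCommGroup T] [Module A T]
    (N : Type) [AddCommGroup N] [Module A N] :
    Module (Module.End A T)ᵐᵒᵖ (T →ₗ[A] N) where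
  smul b f := f ∘ₗ b.unop
  one_smul f := rfl
  mul_smul x y f := rfl
  smul_zero b := rfl
  smul_add b f g := rfl
  add_smul x y f := by
    show f ∘ₗ (x.unop + y.unop) = f ∘ₗ x.unop + f ∘ₗ y.unop
    ext t
    simp
  zero_smul f := by
    show f ∘ₗ (0 : Module.End A T) = 0
    ext t
    simp

@[simp] lemma endOpModule_smul_def (A : Type) [Ring A] (T : Type) [AddCommGroup T]
    [Module A T] (N : Type) [AddCommGroup N] [Module A N]
    (b : (Module.End A T)ᵐᵒᵖ) (f : T →ₗ[A] N) : b • f = f ∘ₗ b.unop := rfl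

/-- Precomposition with `g : N → N'`, as a map of left `End_A T`-modules
`Hom_A(N', T) → Hom_A(N, T)`. -/
def homPrecomp (A : Type) [Ring A] {T N N' : Type} [AddCommGroup T] [Module A T]
    [AddCommGroup N] [Module A N] [AddCommGroup N'] [Module A N'] (g : N →ₗ[A] N') :
    (N' →ₗ[A] T) →ₗ[Module.End A T] (N →ₗ[A] T) where
  toFun f := f ∘ₗ g
  map_add' f₁ f₂ := rfl
  map_smul' b f := rfl

/-- Postcomposition with `g : N → N'`, as a map of right `End_A T`-modules
`Hom_A(T, N) → Hom_A(T, N')`. -/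
def homPostcomp (A : Type) [Ring A] {T N N' : Type} [AddCommGroup T] [Module A T]
    [AddCommGroup N] [Module A N] [AddCommGroup N'] [Module A N'] (g : N →ₗ[A] N') :
    (T →ₗ[A] N) →ₗ[(Module.End A T)ᵐᵒᵖ] (T →ₗ[A] N') where
  toFun f := g ∘ₗ f
  map_add' f₁ f₂ := by ext t; simp
  map_smul' b f := rfl

lemma sc_dep {k : Type} [Field k] (S : ShortComplex (ModuleCat.{0} k))
    (h : Module.finrank k S.homology = 1) (x y : S.X₂) (hx : S.g x = 0) (hy : S.g y = 0) :
    ∃ a b : k, (a ≠ 0 ∨ b ≠ 0) ∧ ∃ z : S.X₁, S.f z = a • x + b • y := by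
  have lift : ∀ x : S.X₂, S.g x = 0 → ∃ z : S.cycles, S.iCycles z = x := by
    intro x hx
    refine ⟨S.moduleCatCyclesIso.inv ⟨x, hx⟩, ?_⟩
    exact congrArg (fun t : S.moduleCatLeftHomologyData.K ⟶ S.X₂ => t.hom ⟨x, hx⟩)
      S.moduleCatCyclesIso_inv_iCycles
  obtain ⟨u, hu⟩ := lift x hx
  obtain ⟨v, hv⟩ := lift y hy
  obtain ⟨a, b, hab, h0⟩ : ∃ a b : k, (a ≠ 0 ∨ b ≠ 0) ∧
      a • S.homologyπ u + b • S.homologyπ v = 0 := by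
    by_cases hu0 : S.homologyπ u = 0
    · exact ⟨1, 0, by simp, by simp [hu0]⟩
    · obtain ⟨c, hc⟩ := (finrank_eq_one_iff_of_nonzero' _ hu0).1 h (S.homologyπ v)
      exact ⟨c, -1, by simp, by rw [hc]; simp⟩
  refine ⟨a, b, hab, ?_⟩
  have h1 : S.homologyπ (a • u + b • v) = 0 := by
    rw [map_add, map_smul, map_smul, h0]
  have h2 : S.pOpcycles (a • x + b • y) = 0 := by
    have : S.pOpcycles (S.iCycles (a • u + b • v)) = 0 := by
      rw [← ModuleCat.comp_apply, ← S.homology_π_ι, ModuleCat.comp_apply, h1, map_zero]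
    rwa [map_add, map_smul, map_smul, hu, hv] at this
  rw [ShortComplex.moduleCat_pOpcycles_eq_zero_iff] at h2
  exact h2

open Limits in
lemma ext_dep {k : Type} [Field k] {C : Type 1} [Category.{0} C] [Abelian C] [Linear k C]
    [EnoughProjectives C] (S : ShortComplex C) (hS : S.ShortExact) (Z : C)
    (h : Module.finrank k (((Ext k C 1).obj (Opposite.op Z)).obj S.X₁) = 1)
    (f₁ f₂ : Z ⟶ S.X₃) :
    ∃ a b : k, (a ≠ 0 ∨ b ≠ 0) ∧ ∃ l : Z ⟶ S.X₂, l ≫ S.g = a • f₁ + b • f₂ := by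
  have := hS.mono_f
  have := hS.epi_g
  let P := projectiveResolution Z
  let K := P.complex.linearYonedaObj k S.X₁
  have e : ((Ext k C 1).obj (Opposite.op Z)).obj S.X₁ ≅ (K.sc' 0 1 2).homology :=
    P.isoExt 1 S.X₁ ≪≫ ShortComplex.homologyMapIso (K.isoSc' 0 1 2 (by simp) (by simp))
  rw [e.toLinearEquiv.finrank_eq] at h
  let p : P.complex.X 0 ⟶ Z := P.π.f 0
  have hp : P.complex.d 1 0 ≫ p = 0 := P.complex_d_comp_π_f_zero
  have hpepi : Epi p := inferInstanceAs (Epi (P.π.f 0))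
  have lift : ∀ f : Z ⟶ S.X₃, ∃ (g : P.complex.X 0 ⟶ S.X₂) (φ : P.complex.X 1 ⟶ S.X₁),
      g ≫ S.g = p ≫ f ∧ φ ≫ S.f = P.complex.d 1 0 ≫ g ∧ P.complex.d 2 1 ≫ φ = 0 := by
    intro f
    have hg : Projective.factorThru (p ≫ f) S.g ≫ S.g = p ≫ f := Projective.factorThru_comp _ _
    set g := Projective.factorThru (p ≫ f) S.g
    have h0 : (P.complex.d 1 0 ≫ g) ≫ S.g = 0 := by
      rw [Category.assoc, hg, ← Category.assoc, hp, zero_comp]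
    refine ⟨g, hS.exact.lift _ h0, hg, hS.exact.lift_f _ h0, ?_⟩
    rw [← cancel_mono S.f, Category.assoc, hS.exact.lift_f, ← Category.assoc,
      P.complex.d_comp_d, zero_comp, zero_comp]
  obtain ⟨g₁, φ₁, hg₁, hφ₁, hd₁⟩ := lift f₁
  obtain ⟨g₂, φ₂, hg₂, hφ₂, hd₂⟩ := lift f₂
  obtain ⟨a, b, hab, ψ, hψ⟩ := sc_dep (K.sc' 0 1 2) h φ₁ φ₂ hd₁ hd₂
  change P.complex.X 0 ⟶ S.X₁ at ψ
  replace hψ : P.complex.d 1 0 ≫ ψ = a • φ₁ + b • φ₂ := hψ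
  refine ⟨a, b, hab, ?_⟩
  have h0 : P.complex.d 1 0 ≫ (a • g₁ + b • g₂ - ψ ≫ S.f) = 0 := by
    rw [Preadditive.comp_sub, ← Category.assoc, hψ]
    simp [hφ₁, hφ₂]
  let l : Z ⟶ S.X₂ := P.isColimitCokernelCofork.desc (CokernelCofork.ofπ _ h0)
  have hl : p ≫ l = a • g₁ + b • g₂ - ψ ≫ S.f :=
    P.isColimitCokernelCofork.fac (CokernelCofork.ofπ _ h0) WalkingParallelPair.one
  refine ⟨l, ?_⟩
  rw [← cancel_epi p, ← Category.assoc, hl]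
  simp [hg₁, hg₂]

/-- scalar multiplication by an element of `k`. -/
def scal (k : Type) [Field k] (A : Type) [Ring A] [Algebra k A] (M : Type) [AddCommGroup M]
    [Module A M] (c : k) : M →ₗ[A] M where
  toFun m := algebraMap k A c • m
  map_add' := smul_add _
  map_smul' a m := by
    simp only [RingHom.id_apply, smul_smul, Algebra.commutes]

lemma hom_dep {k : Type} [Field k] {A : Type} [Ring A] [Algebra k A] {X Y E : Type}
    [AddCommGroup X] [Module A X] [AddCommGroup Y] [Module A Y] [AddCommGroup E] [Module A E]
    (μ : Y →ₗ[A] E) (ε : E →ₗ[A] X)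
    (hμ : Function.Injective μ) (hε : Function.Surjective ε)
    (hexact : LinearMap.range μ = LinearMap.ker ε)
    (hext1 : Module.finrank k (((Ext k (ModuleCat.{0} A) 1).obj
        (Opposite.op (ModuleCat.of A X))).obj (ModuleCat.of A Y)) = 1)
    (hid : ¬ ∃ l : X →ₗ[A] E, ε ∘ₗ l = LinearMap.id) (f : X →ₗ[A] X) :
    ∃ (c : k) (l : X →ₗ[A] E), f = scal k A X c + ε ∘ₗ l := by
  have hz : ModuleCat.ofHom μ ≫ ModuleCat.ofHom ε = 0 := by
    ext y
    have : μ y ∈ LinearMap.ker ε := hexact ▸ ⟨y, rfl⟩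
    exact this
  have hS : (ShortComplex.mk (ModuleCat.ofHom μ) (ModuleCat.ofHom ε) hz).ShortExact := by
    apply ModuleCat.shortComplex_shortExact
    · exact LinearMap.exact_iff.2 hexact.symm
    · exact hμ
    · exact hε
  obtain ⟨a, b, hab, l, hl⟩ := ext_dep _ hS (ModuleCat.of A X) hext1 (𝟙 _) (ModuleCat.ofHom f)
  have hl' : ∀ x : X, ε (l.hom x) = algebraMap k A a • x + algebraMap k A b • f x := fun x =>
    congrArg (fun t : ModuleCat.of A X ⟶ ModuleCat.of A X => t.hom x) hl
  have inv : ∀ (c : k), c ≠ 0 → ∀ x : X, algebraMap k A c⁻¹ • algebraMap k A c • x = x := by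
    intro c hc x
    rw [smul_smul, ← map_mul, inv_mul_cancel₀ hc, map_one, one_smul]
  have hb : b ≠ 0 := by
    rintro rfl
    have ha : a ≠ 0 := by simpa using hab
    refine hid ⟨l.hom ∘ₗ scal k A X a⁻¹, ?_⟩
    ext x
    have := hl' (scal k A X a⁻¹ x)
    simp only [map_zero, zero_smul, add_zero] at this
    refine this.trans ?_
    change algebraMap k A a • algebraMap k A a⁻¹ • x = x
    rw [smul_smul, ← map_mul, mul_inv_cancel₀ ha, map_one, one_smul]
  refine ⟨-(b⁻¹ * a), l.hom ∘ₗ scal k A X b⁻¹, ?_⟩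
  ext x
  have h1 := hl' (scal k A X b⁻¹ x)
  have h2 : f (scal k A X b⁻¹ x) = algebraMap k A b⁻¹ • f x := map_smul _ _ _
  rw [h2, smul_smul _ _ (f x), ← map_mul, mul_inv_cancel₀ hb, map_one, one_smul] at h1
  change f x = algebraMap k A (-(b⁻¹ * a)) • x + ε (l.hom (scal k A X b⁻¹ x))
  refine Eq.trans ?_ (congrArg _ h1.symm)
  change f x = algebraMap k A (-(b⁻¹ * a)) • x + (algebraMap k A a • algebraMap k A b⁻¹ • x + f x)
  rw [smul_smul, ← map_mul, ← add_assoc, ← add_smul, ← map_add, mul_comm a]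
  simp

/-- the cokernel of `ε_* = Hom_A(T, ε) : Hom_A(T,E) → Hom_A(T,X)` is a simple
right `B`-module, where `B = End_A(T)` and `T = U ⊕ X`. -/
theorem coker_hom_T_eps_simple
    (k : Type) [Field k] [IsAlgClosed k]
    (A : Type) [Ring A] [Algebra k A] [FiniteDimensional k A]
    (U X Y E : Type)
    [AddCommGroup U] [Module A U] [Module.Finite A U]
    [AddCommGroup X] [Module A X] [Module.Finite A X]
    [AddCommGroup Y] [Module A Y] [Module.Finite A Y]
    [AddCommGroup E] [Module A E] [Module.Finite A E]
    (hbasic : IsBasicModule A (U × X))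
    (hst : IsSemiTilting k A (U × X))
    (hX : IsIndecomposableModule A X)
    (hXU : ¬ InAdd A U X)
    (hgen : InGen A U X)
    (μ : Y →ₗ[A] E) (ε : E →ₗ[A] X)
    (hμ : Function.Injective μ) (hε : Function.Surjective ε)
    (hexact : LinearMap.range μ = LinearMap.ker ε)
    (hmin : IsMinimalRightAddApprox A U ε)
    (hext1 : Module.finrank k (((Ext k (ModuleCat.{0} A) 1).obj
        (Opposite.op (ModuleCat.of A X))).obj (ModuleCat.of A Y)) = 1) :
    IsSimpleModule (Module.End A (U × X))ᵐᵒᵖ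
      (((U × X) →ₗ[A] X) ⧸ LinearMap.range (homPostcomp A (T := U × X) ε)) := by
  obtain ⟨⟨hE, happ⟩, -⟩ := hmin
  have hid : ¬ ∃ l : X →ₗ[A] E, ε ∘ₗ l = LinearMap.id := by
    rintro ⟨l, hl⟩
    obtain ⟨n, i, p, hip⟩ := hE
    refine hXU ⟨n, i ∘ₗ l, ε ∘ₗ p, ?_⟩
    rw [LinearMap.comp_assoc, ← LinearMap.comp_assoc l i p, hip, LinearMap.id_comp, hl]
  have hUU : InAdd A U U :=
    ⟨1, LinearMap.pi fun _ => LinearMap.id, LinearMap.proj 0, rfl⟩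
  set R := LinearMap.range (homPostcomp A (T := U × X) ε)
  have hmem : ∀ g : (U × X) →ₗ[A] E, ε ∘ₗ g ∈ R := fun g => ⟨g, rfl⟩
  let q : (U × X) →ₗ[A] X := LinearMap.snd A U X
  have hq : q ∉ R := by
    rintro ⟨g, hg⟩
    refine hid ⟨g ∘ₗ LinearMap.inr A U X, ?_⟩
    have hg' : ε ∘ₗ g = q := hg
    rw [← LinearMap.comp_assoc, hg']
    rfl
  have hdec : ∀ f : (U × X) →ₗ[A] X, ∃ c : k, f - scal k A X c ∘ₗ q ∈ R := by
    intro f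
    obtain ⟨c, l, hc⟩ := hom_dep μ ε hμ hε hexact hext1 hid (f ∘ₗ LinearMap.inr A U X)
    obtain ⟨g, hg⟩ := happ U hUU (f ∘ₗ LinearMap.inl A U X)
    refine ⟨c, ?_⟩
    have : f - scal k A X c ∘ₗ q = ε ∘ₗ (g.coprod l) := by
      ext x
      · have := LinearMap.congr_fun hg x
        simpa [q] using this.symm
      · have := LinearMap.congr_fun hc x
        simp only [LinearMap.comp_apply, LinearMap.add_apply, LinearMap.inr_apply] at this
        simp [q, this]
    rw [this]
    exact hmem _
  have hsc : ∀ (c : k) (f : (U × X) →ₗ[A] X),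
      (MulOpposite.op (scal k A (U × X) c) : (Module.End A (U × X))ᵐᵒᵖ) • f
        = scal k A X c ∘ₗ f := by
    intro c f
    apply LinearMap.ext
    intro x
    exact map_smul f _ _
  have hnt : Nontrivial (((U × X) →ₗ[A] X) ⧸ R) := by
    refine ⟨Submodule.Quotient.mk q, 0, fun h => hq ?_⟩
    exact (Submodule.Quotient.mk_eq_zero _).1 h
  rw [isSimpleModule_iff_toSpanSingleton_surjective]
  refine ⟨hnt, ?_⟩
  intro x hx y
  obtain ⟨f, rfl⟩ := Submodule.Quotient.mk_surjective _ x
  obtain ⟨g, rfl⟩ := Submodule.Quotient.mk_surjective _ y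
  obtain ⟨c, hc⟩ := hdec f
  obtain ⟨d, hd⟩ := hdec g
  have hc0 : c ≠ 0 := by
    rintro rfl
    apply hx
    rw [Submodule.Quotient.mk_eq_zero]
    have : f - scal k A X 0 ∘ₗ q = f := by
      apply LinearMap.ext
      intro x
      simp [scal]
    rwa [this] at hc
  refine ⟨MulOpposite.op (scal k A (U × X) (d * c⁻¹)), ?_⟩
  rw [LinearMap.toSpanSingleton_apply, ← Submodule.Quotient.mk_smul, Submodule.Quotient.eq]
  have h1 := R.smul_mem (MulOpposite.op (scal k A (U × X) (d * c⁻¹))) hc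
  rw [hsc] at h1
  rw [hsc]
  have h2 := R.sub_mem h1 hd
  convert h2 using 1
  apply LinearMap.ext
  intro x
  have : algebraMap k A (d * c⁻¹) • algebraMap k A c • q x = algebraMap k A d • q x := by
    rw [smul_smul, ← map_mul, mul_assoc, inv_mul_cancel₀ hc0, mul_one]
  change algebraMap k A (d * c⁻¹) • f x - g x =
    algebraMap k A (d * c⁻¹) • (f x - algebraMap k A c • q x) - (g x - algebraMap k A d • q x)
  rw [smul_sub, this]
  abel
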